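/- Process-level submartingale property of posterior beliefs (Proposition 1, submartingale part): Let K ≥ 1, fix an index i with 1 ≤ i ≤ K, and fix real sequences (u_k^n)_{n ∈ ℕ} and (v_k^n)_{n ∈ ℕ} for each k = 1,…,K. Let Ω = ({−1,1}²)^ℕ, equipped with the product probability measure P_i whose n-th coordinate distribution assigns to each outcome y = (y^c, y^s) ∈ {−1,1}² the probability σ(y^c·u_i^n)·σ(y^s·v_i^n), and with the filtration (F_n)_{n ∈ ℕ} where F_n is generated by the first n coordinates. Given a probability vector q^0 = (q_1^0,…,q_K^0) with q_j^0 > 0 for all j, define recursively q_k^{n+1}(ω) = q_k^n(ω)·σ̃_k^n(ω_{n+1}) / Σ_{j=1}^K q_j^n(ω)·σ̃_j^n(ω_{n+1}), where σ̃_k^n(y) = σ(y^c·u_k^n)·σ(y^s·v_k^n) and ω_{n+1} is the (n+1)-st coordinate of ω. Then the process (q_i^n)_{n ∈ ℕ} is a nonnegative submartingale with respect to (F_n) under P_i. -/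

import Mathlib

open MeasureTheory

/-- The logistic function `σ(h) = 1/(1 + exp(-h))`. -/
noncomputable def sig (h : ℝ) : ℝ := 1 / (1 + Real.exp (-h))

/-- Encoding of an element of `{-1, 1}` by a Boolean: `true ↦ 1`, `false ↦ -1`. -/
def pm (b : Bool) : ℝ := if b then 1 else -1

/-- The likelihood `σ̃(y) = σ(y^c · u) · σ(y^s · v)` of the pair outcome
`y = (y^c, y^s) ∈ {-1,1}²` under the model with parameters `(u, v)`. -/
noncomputable def lik (u v : ℝ) (y : Bool × Bool) : ℝ :=
  sig (pm y.1 * u) * sig (pm y.2 * v)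

/-- The sample space `Ω = ({-1,1}²)^ℕ` of infinite sequences of pair outcomes. -/
abbrev TLOmega : Type := ℕ → Bool × Bool

/-- The sequence of posterior beliefs: `qproc u v q0 n ω k` is the posterior probability
`q_k^n(ω)` of the `k`-th candidate model after the first `n` observations, obtained by
Bayesian updating from the prior `q0` via
`q_k^{n+1}(ω) = q_k^n(ω)·σ̃_k^n(ω_{n+1}) / Σ_j q_j^n(ω)·σ̃_j^n(ω_{n+1})`. -/
noncomputable def qproc {K : ℕ} (u v : ℕ → Fin K → ℝ) (q0 : Fin K → ℝ) :
    ℕ → TLOmega → Fin K → ℝ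
  | 0, _, k => q0 k
  | n + 1, ω, k =>
      qproc u v q0 n ω k * lik (u n k) (v n k) (ω n) /
        ∑ j, qproc u v q0 n ω j * lik (u n j) (v n j) (ω n)

/-- The natural filtration of the coordinate process: `F_n` is generated by the first `n`
coordinates. -/
def coordFiltration : Filtration ℕ (inferInstance : MeasurableSpace TLOmega) where
  seq n := MeasurableSpace.comap (fun ω : TLOmega => fun m : Fin n => ω m) inferInstance
  mono' := by
    intro m n hmn
    have hcomp : (fun ω : TLOmega => fun j : Fin m => ω j) =
        (fun f : Fin n → Bool × Bool => fun j : Fin m => f (Fin.castLE hmn j)) ∘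
          (fun ω : TLOmega => fun j : Fin n => ω j) := rfl
    show MeasurableSpace.comap (fun ω : TLOmega => fun j : Fin m => ω j) inferInstance ≤
      MeasurableSpace.comap (fun ω : TLOmega => fun j : Fin n => ω j) inferInstance
    rw [hcomp, ← MeasurableSpace.comap_comp]
    exact MeasurableSpace.comap_mono
      ((measurable_pi_lambda _ fun j => measurable_pi_apply _).comap_le)
  le' := fun n =>
    (measurable_pi_lambda _ fun m => measurable_pi_apply _).comap_le

lemma sig_pos (h : ℝ) : 0 < sig h := by
  unfold sig
  positivity

lemma sig_add_sig_neg (h : ℝ) : sig h + sig (-h) = 1 := by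
  simpa [sig, Real.sigmoid_def] using congrArg (Real.sigmoid h + ·) (Real.sigmoid_neg h)

lemma lik_pos (u v : ℝ) (y : Bool × Bool) : 0 < lik u v y :=
  mul_pos (sig_pos _) (sig_pos _)

lemma sum_lik (u v : ℝ) : ∑ y, lik u v y = 1 := by
  have hu := sig_add_sig_neg u
  have hv := sig_add_sig_neg v
  simp only [Fintype.sum_prod_type, Fintype.sum_bool, lik, pm, if_true, Bool.false_eq_true,
    if_false, one_mul, neg_one_mul]
  linear_combination (sig v + sig (-v)) * hu + hv

section Posterior

variable {K : ℕ} (u v : ℕ → Fin K → ℝ) {q0 : Fin K → ℝ}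

lemma qproc_pos (hq0 : ∀ j, 0 < q0 j) (n : ℕ) (ω : TLOmega) (k : Fin K) :
    0 < qproc u v q0 n ω k := by
  induction n generalizing k with
  | zero => exact hq0 k
  | succ n ih =>
    exact div_pos (mul_pos (ih k) (lik_pos _ _ _))
      (Finset.sum_pos (fun j _ => mul_pos (ih j) (lik_pos _ _ _)) ⟨k, Finset.mem_univ k⟩)

lemma sum_qproc (hq0 : ∀ j, 0 < q0 j) (hsum : ∑ j, q0 j = 1) (n : ℕ) (ω : TLOmega) :
    ∑ k, qproc u v q0 n ω k = 1 := by
  cases n with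
  | zero => exact hsum
  | succ n =>
    have hne : (Finset.univ : Finset (Fin K)).Nonempty :=
      Finset.nonempty_of_sum_ne_zero (hsum ▸ one_ne_zero)
    simp only [qproc]
    rw [← Finset.sum_div]
    exact div_self (Finset.sum_pos
      (fun j _ => mul_pos (qproc_pos u v hq0 n ω j) (lik_pos _ _ _)) hne).ne'

lemma qproc_le_one (hq0 : ∀ j, 0 < q0 j) (hsum : ∑ j, q0 j = 1) (n : ℕ) (ω : TLOmega)
    (k : Fin K) : qproc u v q0 n ω k ≤ 1 :=
  (Finset.single_le_sum (fun j _ => (qproc_pos u v hq0 n ω j).le) (Finset.mem_univ k)).trans_eq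
    (sum_qproc u v hq0 hsum n ω)

lemma dependsOn_qproc (n : ℕ) : DependsOn (qproc u v q0 n) (Set.Iio n) := by
  induction n with
  | zero => exact fun _ _ _ => rfl
  | succ n ih =>
    intro ω ω' h
    have hprefix : qproc u v q0 n ω = qproc u v q0 n ω' :=
      ih fun m hm => h m (Set.mem_Iio.2 (Nat.lt_succ_of_lt hm))
    funext k
    simp only [qproc, hprefix, h n (Set.mem_Iio.2 n.lt_succ_self)]

/-- Averaging one Bayesian update of the `i`-th belief over an outcome drawn from the `i`-th model
does not decrease that belief. -/
lemma le_sum_lik_mul_posterior {a b q : Fin K → ℝ} (hq : ∀ j, 0 < q j) (hsum : ∑ j, q j = 1)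
    (i : Fin K) :
    q i ≤ ∑ y, lik (a i) (b i) y *
      (q i * lik (a i) (b i) y / ∑ j, q j * lik (a j) (b j) y) := by
  have hmarginal : ∑ y, ∑ j, q j * lik (a j) (b j) y = 1 := by
    rw [Finset.sum_comm]
    simp only [← Finset.mul_sum, sum_lik, mul_one, hsum]
  have hcauchy := Finset.sq_sum_div_le_sum_sq_div Finset.univ (lik (a i) (b i))
    (g := fun y => ∑ j, q j * lik (a j) (b j) y)
    fun y _ => Finset.sum_pos (fun j _ => mul_pos (hq j) (lik_pos _ _ _)) ⟨i, Finset.mem_univ i⟩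
  rw [sum_lik, hmarginal, one_pow, div_one] at hcauchy
  calc q i = q i * 1 := (mul_one _).symm
    _ ≤ q i * ∑ y, lik (a i) (b i) y ^ 2 / ∑ j, q j * lik (a j) (b j) y :=
      mul_le_mul_of_nonneg_left hcauchy (hq i).le
    _ = _ := by
      rw [Finset.mul_sum]
      exact Finset.sum_congr rfl fun y _ => by ring

end Posterior

/-- The infinite sequence that starts with `s` and is constant afterwards. -/
def extendPrefix {n : ℕ} (s : Fin n → Bool × Bool) : TLOmega :=
  fun m => if h : m < n then s ⟨m, h⟩ else default

lemma extendPrefix_apply {n m : ℕ} (s : Fin n → Bool × Bool) (h : m < n) :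
    extendPrefix s m = s ⟨m, h⟩ := dif_pos h

lemma extendPrefix_snoc_of_lt {n m : ℕ} (s : Fin n → Bool × Bool) (y : Bool × Bool) (h : m < n) :
    extendPrefix (Fin.snoc s y : Fin (n + 1) → Bool × Bool) m = extendPrefix s m := by
  rw [extendPrefix_apply _ (Nat.lt_succ_of_lt h), extendPrefix_apply _ h]
  exact Fin.snoc_castSucc (α := fun _ => Bool × Bool) y s ⟨m, h⟩

lemma extendPrefix_snoc_self {n : ℕ} (s : Fin n → Bool × Bool) (y : Bool × Bool) :
    extendPrefix (Fin.snoc s y : Fin (n + 1) → Bool × Bool) n = y := by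
  rw [extendPrefix_apply _ n.lt_succ_self]
  exact Fin.snoc_last (α := fun _ => Bool × Bool) y s

lemma sum_prefix_succ {n : ℕ} (f : (Fin (n + 1) → Bool × Bool) → ℝ) :
    ∑ s, f s = ∑ s : Fin n → Bool × Bool, ∑ y, f (Fin.snoc s y) := by
  rw [← (Fin.snocEquiv fun _ => Bool × Bool).sum_comp, Fintype.sum_prod_type_right]
  rfl

lemma DependsOn.eq_extendPrefix {β : Type*} {n : ℕ} {f : TLOmega → β}
    (hf : DependsOn f (Set.Iio n)) (ω : TLOmega) :
    f ω = f (extendPrefix fun m : Fin n => ω m) :=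
  hf fun _ hm => (extendPrefix_apply (fun m : Fin n => ω m) hm).symm

lemma measurable_prefix (n : ℕ) : Measurable fun (ω : TLOmega) (m : Fin n) => ω m :=
  measurable_pi_lambda _ fun _ => measurable_pi_apply _

lemma DependsOn.stronglyMeasurable_coordFiltration {n : ℕ} {f : TLOmega → ℝ}
    (hf : DependsOn f (Set.Iio n)) : StronglyMeasurable[coordFiltration n] f := by
  have hcomp : f = (fun s => f (extendPrefix s)) ∘ fun (ω : TLOmega) (m : Fin n) => ω m :=
    funext hf.eq_extendPrefix
  rw [hcomp]
  exact ((measurable_of_finite _).comp (comap_measurable _)).stronglyMeasurable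

/-- Events in the `n`-th coordinate sigma-algebra depend on the first `n` coordinates only. -/
lemma dependsOn_mem_of_measurableSet {n : ℕ} {s : Set TLOmega}
    (hs : MeasurableSet[coordFiltration n] s) : DependsOn (· ∈ s) (Set.Iio n) := by
  obtain ⟨t, -, rfl⟩ := hs
  intro ω ω' h
  have hprefix : (fun m : Fin n => ω m) = fun m : Fin n => ω' m := funext fun m => h m m.isLt
  simp only [Set.mem_preimage, hprefix]

lemma integral_eq_sum_prefix {P : Measure TLOmega} [IsFiniteMeasure P] {n : ℕ} {f : TLOmega → ℝ}
    (hf : DependsOn f (Set.Iio n)) :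
    ∫ ω, f ω ∂P =
      ∑ s : Fin n → Bool × Bool, P.real {ω | ∀ m : Fin n, ω m = s m} * f (extendPrefix s) := by
  rw [integral_congr_ae (.of_forall hf.eq_extendPrefix),
    ← integral_map_of_stronglyMeasurable (measurable_prefix n)
      (f := fun s => f (extendPrefix s)) (measurable_of_finite _).stronglyMeasurable,
    integral_fintype .of_finite]
  refine Finset.sum_congr rfl fun s _ => ?_
  rw [map_measureReal_apply (measurable_prefix n) (measurableSet_singleton s), smul_eq_mul]
  congr 2
  ext ω
  simp [funext_iff]

/-- Process-level submartingale property of posterior beliefs (Proposition 1, submartingale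
part): under the product probability measure `P` whose `n`-th coordinate distribution gives
the outcome `y = (y^c, y^s)` probability `σ(y^c·u_i^n)·σ(y^s·v_i^n)` (i.e. outcomes are drawn
from model `i`), the posterior probability process `(q_i^n)_n` of model `i` is a nonnegative
submartingale with respect to the coordinate filtration. -/
theorem posterior_nonneg_submartingale {K : ℕ} (hK : 1 ≤ K) (i : Fin K)
    (u v : ℕ → Fin K → ℝ)
    (P : Measure TLOmega) (hprob : IsProbabilityMeasure P)
    (hP : ∀ (n : ℕ) (s : Fin n → Bool × Bool),
      P {ω : TLOmega | ∀ m : Fin n, ω m = s m} =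
        ∏ m : Fin n, ENNReal.ofReal (lik (u m i) (v m i) (s m)))
    (q0 : Fin K → ℝ) (hq0 : ∀ j, 0 < q0 j) (hsum : ∑ j, q0 j = 1) :
    Submartingale (fun n ω => qproc u v q0 n ω i) coordFiltration P ∧
      ∀ n ω, 0 ≤ qproc u v q0 n ω i := by
  have hmass (n : ℕ) (s : Fin n → Bool × Bool) :
      P.real {ω : TLOmega | ∀ m : Fin n, ω m = s m} = ∏ m : Fin n, lik (u m i) (v m i) (s m) := by
    rw [measureReal_def, hP, ENNReal.toReal_prod]
    exact Finset.prod_congr rfl fun m _ => ENNReal.toReal_ofReal (lik_pos _ _ _).le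
  have hdep (n : ℕ) : DependsOn (fun ω => qproc u v q0 n ω i) (Set.Iio n) :=
    fun _ _ h => congrFun (dependsOn_qproc u v n h) i
  have hadapted : StronglyAdapted coordFiltration fun n ω => qproc u v q0 n ω i :=
    fun n => (hdep n).stronglyMeasurable_coordFiltration
  refine ⟨submartingale_of_setIntegral_le_succ hadapted (fun n => ?_) fun n A hA => ?_,
    fun n ω => (qproc_pos u v hq0 n ω i).le⟩
  · refine .of_bound ((hadapted n).mono (coordFiltration.le n)).aestronglyMeasurable 1
      (.of_forall fun ω => ?_)
    rw [Real.norm_of_nonneg (qproc_pos u v hq0 n ω i).le]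
    exact qproc_le_one u v hq0 hsum n ω i
  · classical
    have hAdep := dependsOn_mem_of_measurableSet hA
    have hind {m : ℕ} (hnm : n ≤ m) :
        DependsOn (A.indicator fun ω => qproc u v q0 m ω i) (Set.Iio m) := by
      intro ω ω' h
      have hmem : (ω ∈ A) = (ω' ∈ A) := hAdep fun k hk => h k (Set.Iio_subset_Iio hnm hk)
      simp only [Set.indicator_apply, hmem, hdep m h]
    rw [← integral_indicator (coordFiltration.le n A hA),
      ← integral_indicator (coordFiltration.le n A hA),
      integral_eq_sum_prefix (hind le_rfl), integral_eq_sum_prefix (hind n.le_succ),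
      sum_prefix_succ]
    refine Finset.sum_le_sum fun s _ => ?_
    have hprefix (y : Bool × Bool) (k : ℕ) (hk : k ∈ Set.Iio n) :
        extendPrefix (Fin.snoc s y : Fin (n + 1) → Bool × Bool) k = extendPrefix s k :=
      extendPrefix_snoc_of_lt s y hk
    have hmem (y : Bool × Bool) :
        (extendPrefix (Fin.snoc s y : Fin (n + 1) → Bool × Bool) ∈ A) = (extendPrefix s ∈ A) :=
      hAdep (hprefix y)
    have hq (y : Bool × Bool) :
        qproc u v q0 n (extendPrefix (Fin.snoc s y : Fin (n + 1) → Bool × Bool)) =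
          qproc u v q0 n (extendPrefix s) :=
      dependsOn_qproc u v n (hprefix y)
    simp only [hmass, Set.indicator_apply, hmem, Fin.prod_univ_castSucc,
      Fin.snoc_castSucc, Fin.snoc_last, Fin.val_castSucc, Fin.val_last]
    split_ifs
    · simp only [qproc, hq, extendPrefix_snoc_self, mul_assoc (∏ _, _), ← Finset.mul_sum]
      exact mul_le_mul_of_nonneg_left
        (le_sum_lik_mul_posterior (qproc_pos u v hq0 n _) (sum_qproc u v hq0 hsum n _) i)
        (Finset.prod_nonneg fun _ _ => (lik_pos _ _ _).le)
    · simp
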